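/- There is no sequence p_n → +∞ along which (r_{p_n} − s_{p_n})/ε_{p_n}⁺ → −∞; equivalently, liminf_{p→+∞} (r_p − s_p)/ε_p⁺ > −∞. -/

import Mathlib

open Real MeasureTheory Set Filter

noncomputable section

/-- The radial energy functional for the Lane–Emden problem on the unit ball of `ℝ²`
(written in polar coordinates; the common factor `2π` is dropped). -/
def radialEnergy (p : ℝ) (v : ℝ → ℝ) : ℝ :=
  (1 / 2) * (∫ r in (0:ℝ)..1, (deriv v r) ^ 2 * r)
    - (1 / (p + 1)) * ∫ r in (0:ℝ)..1, |v r| ^ (p + 1) * r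

/-- The Nehari identity `∫_B |∇v⁺|² = ∫_B |v⁺|^{p+1}` for the positive part,
written in polar coordinates. -/
def nehariPos (p : ℝ) (v : ℝ → ℝ) : Prop :=
  (∫ r in (0:ℝ)..1, (if 0 < v r then (deriv v r) ^ 2 * r else 0))
    = ∫ r in (0:ℝ)..1, (max (v r) 0) ^ (p + 1) * r

/-- The Nehari identity `∫_B |∇v⁻|² = ∫_B |v⁻|^{p+1}` for the negative part,
written in polar coordinates. -/
def nehariNeg (p : ℝ) (v : ℝ → ℝ) : Prop :=
  (∫ r in (0:ℝ)..1, (if v r < 0 then (deriv v r) ^ 2 * r else 0))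
    = ∫ r in (0:ℝ)..1, (max (-v r) 0) ^ (p + 1) * r

/-- A family `p ↦ u p` (for `p > 1`) of least energy nodal radial solutions of the
Lane–Emden problem `−Δu = |u|^{p−1}u` in the unit ball `B ⊆ ℝ²`, `u = 0` on `∂B`,
described through the radial profile `u p : ℝ → ℝ`.  `rp p ∈ (0,1)` is the nodal
radius, `sp p ∈ (rp p, 1)` is a radius where `u p` attains `‖(u p)⁺‖_∞`; the solution
is negative in the inner nodal region (`u p 0 < 0`), attains `-‖(u p)⁻‖_∞` at `0`,
and minimizes the energy among radial members of the nodal Nehari set. -/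
structure LaneEmdenFamily where
  u : ℝ → ℝ → ℝ
  rp : ℝ → ℝ
  sp : ℝ → ℝ
  smooth : ∀ p, 1 < p → ContDiffOn ℝ 2 (u p) (Icc (0:ℝ) 1)
  ode : ∀ p, 1 < p → ∀ r ∈ Ioo (0:ℝ) 1,
    -deriv (deriv (u p)) r - deriv (u p) r / r = |u p r| ^ (p - 1) * u p r
  derivAtZero : ∀ p, 1 < p → deriv (u p) 0 = 0
  boundary : ∀ p, 1 < p → u p 1 = 0
  center_neg : ∀ p, 1 < p → u p 0 < 0
  min_at_zero : ∀ p, 1 < p → ∀ r ∈ Icc (0:ℝ) 1, u p 0 ≤ u p r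
  rp_mem : ∀ p, 1 < p → rp p ∈ Ioo (0:ℝ) 1
  rp_zero : ∀ p, 1 < p → u p (rp p) = 0
  neg_in : ∀ p, 1 < p → ∀ r ∈ Ico (0:ℝ) (rp p), u p r < 0
  pos_out : ∀ p, 1 < p → ∀ r ∈ Ioo (rp p) 1, 0 < u p r
  sp_mem : ∀ p, 1 < p → sp p ∈ Ioo (rp p) 1
  sp_max : ∀ p, 1 < p → ∀ r ∈ Icc (0:ℝ) 1, u p r ≤ u p (sp p)
  least_energy : ∀ p, 1 < p → ∀ v : ℝ → ℝ,
    ContDiffOn ℝ 1 v (Icc (0:ℝ) 1) → v 1 = 0 →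
    (∃ r ∈ Ioo (0:ℝ) 1, 0 < v r) → (∃ r ∈ Ioo (0:ℝ) 1, v r < 0) →
    nehariPos p v → nehariNeg p v →
    radialEnergy p (u p) ≤ radialEnergy p v

/-- `ε_p⁺`, defined by `(ε_p⁺)⁻² = p · ‖u_p⁺‖_∞^{p−1} = p · u_p(s_p)^{p−1}`. -/
def epsP (F : LaneEmdenFamily) (p : ℝ) : ℝ :=
  1 / Real.sqrt (p * F.u p (F.sp p) ^ (p - 1))

/-- `ε_p⁻`, defined by `(ε_p⁻)⁻² = p · ‖u_p⁻‖_∞^{p−1} = p · |u_p(0)|^{p−1}`. -/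
def epsM (F : LaneEmdenFamily) (p : ℝ) : ℝ :=
  1 / Real.sqrt (p * (-F.u p 0) ^ (p - 1))

theorem le_of_hasDerivAt_nonneg {f f' : ℝ → ℝ} {a b : ℝ} (hab : a ≤ b)
    (hf : ContinuousOn f (Icc a b)) (hd : ∀ x ∈ Ioo a b, HasDerivAt f (f' x) x)
    (h : ∀ x ∈ Ioo a b, 0 ≤ f' x) : f a ≤ f b := by
  refine monotoneOn_of_hasDerivWithinAt_nonneg (f' := f') (convex_Icc a b) hf ?_ ?_
    (left_mem_Icc.2 hab) (right_mem_Icc.2 hab) hab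
  · intro x hx
    rw [interior_Icc] at hx
    exact (hd x hx).hasDerivWithinAt
  · intro x hx
    rw [interior_Icc] at hx
    exact h x hx

/-- `w` is a positive solution of the radial equation `-(r w')' = r w ^ p` on `(a, b)`, written
as a first order system with flux `E = r w'`. -/
structure PosRadialSolution (p : ℝ) (w E : ℝ → ℝ) (a b : ℝ) : Prop where
  nonneg_left : 0 ≤ a
  cont : ContinuousOn w (Icc a b)
  cont_flux : ContinuousOn E (Icc a b)
  deriv : ∀ r ∈ Ioo a b, HasDerivAt w (E r / r) r
  deriv_flux : ∀ r ∈ Ioo a b, HasDerivAt E (-(r * w r ^ p)) r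
  pos : ∀ r ∈ Ioo a b, 0 < w r

namespace PosRadialSolution

variable {p : ℝ} {w E : ℝ → ℝ} {a b c d K k : ℝ}

theorem mono (h : PosRadialSolution p w E a b) (hac : a ≤ c) (hdb : d ≤ b) :
    PosRadialSolution p w E c d where
  nonneg_left := h.nonneg_left.trans hac
  cont := h.cont.mono (Icc_subset_Icc hac hdb)
  cont_flux := h.cont_flux.mono (Icc_subset_Icc hac hdb)
  deriv r hr := h.deriv r (Ioo_subset_Ioo hac hdb hr)
  deriv_flux r hr := h.deriv_flux r (Ioo_subset_Ioo hac hdb hr)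
  pos r hr := h.pos r (Ioo_subset_Ioo hac hdb hr)

theorem flux_le (h : PosRadialSolution p w E a b) (hab : a ≤ b) (hp : 0 ≤ p) (hk : 0 ≤ k)
    (hw : ∀ r ∈ Ioo a b, k ≤ w r) : E b ≤ E a - k ^ p * ((b ^ 2 - a ^ 2) / 2) := by
  have := le_of_hasDerivAt_nonneg (f := fun r => -E r - k ^ p * (r ^ 2 / 2))
    (f' := fun r => r * w r ^ p - k ^ p * r) hab
    (h.cont_flux.neg.sub (by fun_prop))
    (fun r hr => by
      have h1 := (h.deriv_flux r hr).neg
      have h2 := (((hasDerivAt_id r).pow 2).div_const 2).const_mul (k ^ p)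
      refine (h1.sub h2).congr_deriv ?_
      simp only [id]; push_cast; ring)
    (fun r hr => by
      have h0 : 0 ≤ r := h.nonneg_left.trans hr.1.le
      have := Real.rpow_le_rpow hk (hw r hr) hp
      nlinarith)
  linarith

theorem le_flux (h : PosRadialSolution p w E a b) (hab : a ≤ b) (hp : 0 ≤ p)
    (hw : ∀ r ∈ Ioo a b, w r ≤ K) : E a - K ^ p * ((b ^ 2 - a ^ 2) / 2) ≤ E b := by
  have := le_of_hasDerivAt_nonneg (f := fun r => E r + K ^ p * (r ^ 2 / 2))
    (f' := fun r => -(r * w r ^ p) + K ^ p * r) hab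
    (h.cont_flux.add (by fun_prop))
    (fun r hr => by
      have h1 := (h.deriv_flux r hr)
      have h2 := (((hasDerivAt_id r).pow 2).div_const 2).const_mul (K ^ p)
      refine (h1.add h2).congr_deriv ?_
      simp only [id]; push_cast; ring)
    (fun r hr => by
      have h0 : 0 ≤ r := h.nonneg_left.trans hr.1.le
      have := Real.rpow_le_rpow (h.pos r hr).le (hw r hr) hp
      nlinarith)
  linarith

theorem flux_anti (h : PosRadialSolution p w E a b) (hab : a ≤ b) (hp : 0 < p) : E b ≤ E a := by
  have := h.flux_le hab hp.le le_rfl (fun r hr => (h.pos r hr).le)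
  rw [Real.zero_rpow hp.ne'] at this
  linarith

/-- Integrated Pohozaev inequality. -/
theorem pohozaev (h : PosRadialSolution p w E a b) (hab : a ≤ b) (hp : 0 < p)
    (hw : ∀ r ∈ Ioo a b, w r ≤ K) :
    E b ^ 2 / 2 + b ^ 2 * w b ^ (p + 1) / (p + 1) + 2 * K / (p + 1) * E b ≤
      E a ^ 2 / 2 + a ^ 2 * w a ^ (p + 1) / (p + 1) + 2 * K / (p + 1) * E a := by
  have := le_of_hasDerivAt_nonneg
    (f := fun r => -(E r ^ 2 / 2 + r ^ 2 * w r ^ (p + 1) / (p + 1) + 2 * K / (p + 1) * E r))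
    (f' := fun r => 2 / (p + 1) * (r * w r ^ p) * (K - w r)) hab
    ((((h.cont_flux.pow 2).div_const 2).add
      (((continuousOn_id.pow 2).mul (h.cont.rpow_const
        (fun x _ => Or.inr (by linarith)))).div_const _)).add
      (h.cont_flux.const_mul _)).neg
    (fun r hr => by
      have h0 : 0 < r := h.nonneg_left.trans_lt hr.1
      have hE := h.deriv_flux r hr
      have hw' := (h.deriv r hr).rpow_const (p := p + 1) (Or.inl (h.pos r hr).ne')
      have h1 := (hE.pow 2).div_const 2
      have h2 := ((((hasDerivAt_id r).pow 2).mul hw').div_const (p + 1))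
      have h3 := hE.const_mul (2 * K / (p + 1))
      refine ((h1.add h2).add h3).neg.congr_deriv ?_
      have e1 : p + 1 - 1 = p := by ring
      have e2 : w r ^ (p + 1) = w r ^ p * w r := by
        rw [Real.rpow_add (h.pos r hr), Real.rpow_one]
      have hp1 : p + 1 ≠ 0 := by linarith
      simp only [e1, e2, id, Pi.pow_apply]
      field_simp
      push_cast
      ring)
    (fun r hr => by
      have h0 : 0 ≤ r := h.nonneg_left.trans hr.1.le
      have := hw r hr
      have := Real.rpow_nonneg (h.pos r hr).le p
      have : 0 ≤ K - w r := by linarith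
      positivity)
  linarith

theorem sub_le_log (h : PosRadialSolution p w E a b) (ha : 0 < a) (hab : a ≤ b)
    (hE : ∀ r ∈ Ioo a b, E r ≤ c) : w b - w a ≤ c * Real.log (b / a) := by
  have hpos : ∀ x ∈ Icc a b, x ≠ 0 := fun x hx => (ha.trans_le hx.1).ne'
  have := le_of_hasDerivAt_nonneg (f := fun r => c * Real.log r - w r)
    (f' := fun r => c * r⁻¹ - E r / r) hab
    (((continuousOn_id.log hpos).const_mul c).sub h.cont)
    (fun r hr => ((Real.hasDerivAt_log (hpos r ⟨hr.1.le, hr.2.le⟩)).const_mul c).sub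
      (h.deriv r hr))
    (fun r hr => by
      have h0 : 0 < r := ha.trans hr.1
      have := hE r hr
      rw [← div_eq_mul_inv, ← sub_div]
      exact div_nonneg (by linarith) h0.le)
  rw [Real.log_div (ha.trans_le hab).ne' ha.ne']
  linarith

theorem log_le_sub (h : PosRadialSolution p w E a b) (ha : 0 < a) (hab : a ≤ b)
    (hE : ∀ r ∈ Ioo a b, c ≤ E r) : c * Real.log (b / a) ≤ w b - w a := by
  have hpos : ∀ x ∈ Icc a b, x ≠ 0 := fun x hx => (ha.trans_le hx.1).ne'
  have := le_of_hasDerivAt_nonneg (f := fun r => w r - c * Real.log r)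
    (f' := fun r => E r / r - c * r⁻¹) hab
    (h.cont.sub ((continuousOn_id.log hpos).const_mul c))
    (fun r hr => (h.deriv r hr).sub
      ((Real.hasDerivAt_log (hpos r ⟨hr.1.le, hr.2.le⟩)).const_mul c))
    (fun r hr => by
      have h0 : 0 < r := ha.trans hr.1
      have := hE r hr
      rw [← div_eq_mul_inv, ← sub_div]
      exact div_nonneg (by linarith) h0.le)
  rw [Real.log_div (ha.trans_le hab).ne' ha.ne']
  linarith

/-- Parabolic lower bound near the center of a solution on a ball. -/
theorem sub_le_of_center (h : PosRadialSolution p w E 0 b) (hb : 0 ≤ b) (hp : 0 ≤ p)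
    (hE : E 0 = 0) (hw : ∀ r ∈ Ioo 0 b, w r ≤ K) : w 0 - K ^ p * (b ^ 2 / 4) ≤ w b := by
  have := le_of_hasDerivAt_nonneg (f := fun r => w r + K ^ p * (r ^ 2 / 4))
    (f' := fun r => E r / r + K ^ p * (r / 2)) hb
    (h.cont.add (by fun_prop))
    (fun r hr => by
      have h2 := (((hasDerivAt_id r).pow 2).div_const 4).const_mul (K ^ p)
      refine ((h.deriv r hr).add h2).congr_deriv ?_
      simp only [id]; push_cast; ring)
    (fun r hr => by
      have h0 : 0 < r := hr.1
      have := (h.mono le_rfl hr.2.le).le_flux h0.le hp (K := K)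
        (fun x hx => hw x ⟨hx.1, hx.2.trans hr.2⟩)
      rw [hE] at this
      have h3 : E r / r + K ^ p * (r / 2) = (E r + K ^ p * (r ^ 2 / 2)) / r := by
        field_simp
      rw [h3]
      exact div_nonneg (by linarith) h0.le)
  linarith

/-- The flux through the boundary of a ball is at most `4 ‖w‖_∞ / (p + 1)`. -/
theorem neg_flux_le (h : PosRadialSolution p w E 0 b) (hb : 0 ≤ b) (hp : 0 < p)
    (hE : E 0 = 0) (hK : 0 ≤ K) (hw : ∀ r ∈ Ioo 0 b, w r ≤ K) (hwb : w b = 0) :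
    -E b ≤ 4 * K / (p + 1) := by
  have h1 := h.pohozaev hb hp hw
  rw [hE, hwb, Real.zero_rpow (by linarith)] at h1
  have h2 : 0 ≤ 4 * K / (p + 1) := by positivity
  have h3 : 2 * K / (p + 1) = 4 * K / (p + 1) / 2 := by ring
  rw [h3] at h1
  by_contra hc
  push Not at hc
  simp only [mul_zero, zero_div, add_zero, zero_mul, ne_eq, OfNat.ofNat_ne_zero, not_false_eq_true,
    zero_pow] at h1
  nlinarith

/-- The height of a positive solution on a ball of radius `b` is controlled by `b`. -/
theorem center_height (h : PosRadialSolution p w E 0 b) (hb : 0 < b) (hp : 2 ≤ p)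
    (hE : E 0 = 0) (hw0 : 0 < w 0) (hw : ∀ r ∈ Ioo 0 b, w r ≤ w 0) (hwb : w b = 0) :
    p * w 0 ^ (p - 1) * b ^ 2 ≤ 4 * Real.exp (4 * p) := by
  set A := w 0 with hA
  have hp0 : 0 < p := by linarith
  have hAp : A ^ p = A ^ (p - 1) * A := by
    rw [← Real.rpow_add_one hw0.ne']; congr 1; ring
  have hq : 0 < A ^ (p - 1) := Real.rpow_pos_of_pos hw0 _
  have hX : 0 < 4 / (p * A ^ (p - 1)) := by positivity
  obtain ⟨r, hr0, hr2⟩ : ∃ r : ℝ, 0 < r ∧ r ^ 2 = 4 / (p * A ^ (p - 1)) :=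
    ⟨_, Real.sqrt_pos.2 hX, Real.sq_sqrt hX.le⟩
  have hr4 : p * A ^ (p - 1) * r ^ 2 = 4 := by
    rw [hr2]; field_simp
  have hone : (1 : ℝ) ≤ Real.exp (4 * p) := Real.one_le_exp (by positivity)
  rcases le_total b r with hbr | hrb
  · have : b ^ 2 ≤ r ^ 2 := by gcongr
    have : p * A ^ (p - 1) * b ^ 2 ≤ p * A ^ (p - 1) * r ^ 2 := by gcongr
    linarith
  have hApr : A ^ p * r ^ 2 = 4 * A / p := by
    rw [hAp, eq_div_iff hp0.ne']
    linear_combination A * hr4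
  have hlow : ∀ x ∈ Icc 0 r, A * (1 - 1 / p) ≤ w x := by
    intro x hx
    have h1 := (h.mono le_rfl (hx.2.trans hrb)).sub_le_of_center hx.1 hp0.le hE
      (fun y hy => hw y ⟨hy.1, hy.2.trans_le (hx.2.trans hrb)⟩)
    have h2 : A ^ p * x ^ 2 ≤ A ^ p * r ^ 2 := by
      have := hx.1
      have := hx.2
      gcongr
    rw [hApr] at h2
    have h3 : A * (1 - 1 / p) = A - (4 * A / p) / 4 := by ring
    rw [h3]
    linarith
  have hfrac : 0 ≤ 1 - 1 / p := by
    rw [sub_nonneg, div_le_one hp0]; linarith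
  have hquarter : 1 / 4 ≤ (1 - 1 / p) ^ p := by
    have h1 := one_add_mul_self_le_rpow_one_add (s := -(1 / p)) (by linarith) (p := p / 2)
      (by linarith)
    have h2 : 1 + p / 2 * -(1 / p) = 1 / 2 := by field_simp; norm_num
    rw [h2, ← sub_eq_add_neg] at h1
    have h3 : (1 - 1 / p) ^ p = (1 - 1 / p) ^ (p / 2) * (1 - 1 / p) ^ (p / 2) := by
      rw [← Real.rpow_add_of_nonneg hfrac (by linarith) (by linarith)]; congr 1; ring
    rw [h3]
    nlinarith
  have hflux : E r ≤ -(A / (2 * p)) := by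
    have h1 := (h.mono le_rfl hrb).flux_le hr0.le hp0.le (k := A * (1 - 1 / p)) (by positivity)
      (fun x hx => hlow x ⟨hx.1.le, hx.2.le⟩)
    rw [hE, Real.mul_rpow hw0.le hfrac] at h1
    have h2 : A ^ p * (1 - 1 / p) ^ p * ((r ^ 2 - 0 ^ 2) / 2) =
        (4 * A / p) / 2 * (1 - 1 / p) ^ p := by
      rw [← hApr]; ring
    have h3 : (4 * A / p) / 2 * (1 / 4) ≤ (4 * A / p) / 2 * (1 - 1 / p) ^ p := by gcongr
    have h4 : A / (2 * p) = (4 * A / p) / 2 * (1 / 4) := by ring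
    rw [h2] at h1
    rw [h4]
    linarith
  have hlog := (h.mono hr0.le le_rfl).sub_le_log hr0 hrb (c := -(A / (2 * p)))
    (fun x hx => ((h.mono hr0.le hx.2.le).flux_anti hx.1.le hp0).trans hflux)
  have hwr : w r ≤ A := by
    rcases hrb.eq_or_lt with hrb | hrb
    · rw [hrb, hwb]; exact hw0.le
    · exact hw r ⟨hr0, hrb⟩
  have hL : Real.log (b / r) ≤ 2 * p := by
    rw [hwb] at hlog
    have h1 : A / (2 * p) * Real.log (b / r) ≤ A / (2 * p) * (2 * p) := by
      have : A / (2 * p) * (2 * p) = A := by field_simp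
      rw [this]; linarith
    exact le_of_mul_le_mul_left h1 (by positivity)
  rw [Real.log_le_iff_le_exp (by positivity), div_le_iff₀ hr0] at hL
  have h5 : b ^ 2 ≤ (Real.exp (2 * p) * r) ^ 2 := by gcongr
  have h6 : (Real.exp (2 * p) * r) ^ 2 = Real.exp (4 * p) * r ^ 2 := by
    rw [mul_pow, ← Real.exp_nat_mul]; congr 2; push_cast; ring
  rw [h6] at h5
  calc p * A ^ (p - 1) * b ^ 2 ≤ p * A ^ (p - 1) * (Real.exp (4 * p) * r ^ 2) := by gcongr
    _ = 4 * Real.exp (4 * p) := by linear_combination Real.exp (4 * p) * hr4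

/-- If the inner flux is small compared with the inner radius, the solution climbs to a height
at least of order `p` times that flux before reaching its maximum. -/
theorem height_ge (h : PosRadialSolution p w E a b) (ha : 0 < a) (hab : a < b) (hp : 2 ≤ p)
    (hwa : w a = 0) (hEa : 0 < E a) (hEb : E b = 0) (hk : 0 < k)
    (hsmall : (E a * (k * p)) ^ p * (a * Real.exp (k * p)) ^ 2 ≤ E a) :
    E a / 2 * (k * p) ≤ w b := by
  have hp0 : 0 < p := by linarith
  have hkp : 0 < k * p := by positivity
  set c := a * Real.exp (k * p) with hc
  have hlogc : Real.log (c / a) = k * p := by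
    rw [hc, mul_div_cancel_left₀ _ ha.ne', Real.log_exp]
  have hac : a ≤ c := le_mul_of_one_le_right ha.le (Real.one_le_exp hkp.le)
  have hanti : ∀ x ∈ Icc a b, E x ≤ E a := fun x hx => (h.mono le_rfl hx.2).flux_anti hx.1 hp0
  have hup : ∀ x ∈ Icc a b, x ≤ c → w x ≤ E a * (k * p) := by
    intro x hx hxc
    have h1 := (h.mono le_rfl hx.2).sub_le_log ha hx.1 (c := E a)
      (fun y hy => hanti y ⟨hy.1.le, hy.2.le.trans hx.2⟩)
    rw [hwa, sub_zero] at h1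
    refine h1.trans ?_
    rw [← hlogc]
    have : 0 < x := ha.trans_le hx.1
    gcongr
  have hlow : ∀ x ∈ Icc a b, x ≤ c → E a / 2 ≤ E x := by
    intro x hx hxc
    have h1 := (h.mono le_rfl hx.2).le_flux hx.1 hp0.le (K := E a * (k * p))
      (fun y hy => hup y ⟨hy.1.le, hy.2.le.trans hx.2⟩ (hy.2.le.trans hxc))
    have h2 : x ^ 2 - a ^ 2 ≤ c ^ 2 := by
      have : x ^ 2 ≤ c ^ 2 := by
        have : 0 < x := ha.trans_le hx.1
        gcongr
      nlinarith
    have h3 : (E a * (k * p)) ^ p * ((x ^ 2 - a ^ 2) / 2) ≤ (E a * (k * p)) ^ p * (c ^ 2 / 2) := by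
      gcongr
    linarith
  have hcb : c < b := by
    by_contra hcb
    push Not at hcb
    have := hlow b ⟨hab.le, le_rfl⟩ hcb
    linarith
  have h1 := (h.mono le_rfl hcb.le).log_le_sub ha hac (c := E a / 2)
    (fun x hx => hlow x ⟨hx.1.le, hx.2.le.trans hcb.le⟩ hx.2.le)
  have h2 := (h.mono hac le_rfl).log_le_sub (ha.trans_le hac) hcb.le (c := 0)
    (fun x hx => by
      have := (h.mono (hac.trans hx.1.le) le_rfl).flux_anti hx.2.le hp0
      linarith)
  rw [hlogc, hwa] at h1
  linarith

end PosRadialSolution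

theorem flux_smallness {p A D ρ : ℝ} (hp : 2 ≤ p) (hA : 0 < A) (hD : 0 < D)
    (hDA : D ≤ 4 * A / (p + 1)) (hρ : 0 < ρ)
    (hAρ : p * A ^ (p - 1) * ρ ^ 2 ≤ 4 * Real.exp (4 * p)) :
    (D * (Real.exp (-8) * p)) ^ p * (ρ * Real.exp (Real.exp (-8) * p)) ^ 2 ≤ D := by
  have hp0 : 0 < p := by linarith
  have hk1 : Real.exp (-8) ≤ 1 / 2 := by
    have h1 : Real.exp (-8) ≤ Real.exp (-1) := Real.exp_le_exp.2 (by norm_num)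
    have h2 := Real.add_one_le_exp (1 : ℝ)
    have h3 : Real.exp (-1) * Real.exp 1 = 1 := by rw [← Real.exp_add]; simp
    nlinarith [Real.exp_pos (-1 : ℝ)]
  have hk4 : 4 * Real.exp (-8) ≤ Real.exp (-6) := by
    have h1 : Real.exp (-6) = Real.exp (-8) * Real.exp 1 * Real.exp 1 := by
      rw [← Real.exp_add, ← Real.exp_add]; norm_num
    have h2 : (2 : ℝ) ≤ Real.exp 1 := by have := Real.add_one_le_exp (1 : ℝ); linarith
    have h3 : (4 : ℝ) ≤ Real.exp 1 * Real.exp 1 := by nlinarith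
    rw [h1]
    nlinarith [Real.exp_pos (-8 : ℝ)]
  set k := Real.exp (-8) with hk
  have hk0 : 0 < k := Real.exp_pos _
  have hDp : D * p ≤ 4 * A := by
    rw [le_div_iff₀ (by linarith)] at hDA
    nlinarith
  have hX : D * (k * p) ≤ 4 * k * A := by nlinarith
  have hX0 : 0 < D * (k * p) := by positivity
  have e1 : (D * (k * p)) ^ p = (D * (k * p)) ^ (p - 1) * (D * (k * p)) := by
    rw [← Real.rpow_add_one hX0.ne']; congr 1; ring
  have h1 : (D * (k * p)) ^ (p - 1) ≤ (4 * k) ^ (p - 1) * A ^ (p - 1) := by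
    rw [← Real.mul_rpow (by positivity) hA.le]
    exact Real.rpow_le_rpow hX0.le hX (by linarith)
  have e2 : (4 * k) ^ (p - 1) * (4 * k) = (4 * k) ^ p := by
    rw [← Real.rpow_add_one (by positivity)]; congr 1; ring
  have h2 : (4 * k) ^ p ≤ Real.exp (-6 * p) := by
    rw [Real.exp_mul]
    exact Real.rpow_le_rpow (by positivity) hk4 hp0.le
  have h3 : Real.exp (k * p) ^ 2 ≤ Real.exp p := by
    rw [← Real.exp_nat_mul]
    apply Real.exp_le_exp.2
    push_cast
    nlinarith
  calc (D * (k * p)) ^ p * (ρ * Real.exp (k * p)) ^ 2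
      = (D * (k * p)) ^ (p - 1) * (D * (k * p)) * (ρ ^ 2 * Real.exp (k * p) ^ 2) := by
        rw [e1, mul_pow]
    _ ≤ (4 * k) ^ (p - 1) * A ^ (p - 1) * (D * (k * p)) * (ρ ^ 2 * Real.exp p) := by gcongr
    _ = (4 * k) ^ (p - 1) * k * D * Real.exp p * (p * A ^ (p - 1) * ρ ^ 2) := by ring
    _ ≤ (4 * k) ^ (p - 1) * k * D * Real.exp p * (4 * Real.exp (4 * p)) := by gcongr
    _ = (4 * k) ^ p * Real.exp p * Real.exp (4 * p) * D := by rw [← e2]; ring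
    _ ≤ Real.exp (-6 * p) * Real.exp p * Real.exp (4 * p) * D := by gcongr
    _ = Real.exp (-p) * D := by
        rw [← Real.exp_add, ← Real.exp_add]; congr 2; ring
    _ ≤ 1 * D := by
        gcongr
        exact Real.exp_le_one_iff.2 (by linarith)
    _ = D := one_mul D

namespace LaneEmdenFamily

variable (F : LaneEmdenFamily) {p : ℝ}

/-- The radial flux `r u_p'(r)`. -/
def flux (p r : ℝ) : ℝ := r * derivWithin (F.u p) (Icc 0 1) r

theorem continuousOn_flux (hp : 1 < p) : ContinuousOn (F.flux p) (Icc 0 1) :=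
  continuousOn_id.mul ((F.smooth p hp).continuousOn_derivWithin
    (uniqueDiffOn_Icc zero_lt_one) (by norm_num))

theorem flux_eq {r : ℝ} (hr : r ∈ Ioo (0 : ℝ) 1) : F.flux p r = r * deriv (F.u p) r := by
  rw [flux, derivWithin_of_mem_nhds (Icc_mem_nhds hr.1 hr.2)]

theorem hasDerivAt_u (hp : 1 < p) {r : ℝ} (hr : r ∈ Ioo (0 : ℝ) 1) :
    HasDerivAt (F.u p) (F.flux p r / r) r := by
  rw [F.flux_eq hr, mul_div_cancel_left₀ _ hr.1.ne']
  exact (((F.smooth p hp).contDiffAt (Icc_mem_nhds hr.1 hr.2)).differentiableAt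
    (by norm_num)).hasDerivAt

theorem hasDerivAt_flux (hp : 1 < p) {r : ℝ} (hr : r ∈ Ioo (0 : ℝ) 1) :
    HasDerivAt (F.flux p) (-(r * (|F.u p r| ^ (p - 1) * F.u p r))) r := by
  have h2 : ContDiffAt ℝ 2 (F.u p) r := (F.smooth p hp).contDiffAt (Icc_mem_nhds hr.1 hr.2)
  have h1 : HasDerivAt (deriv (F.u p)) (deriv (deriv (F.u p)) r) r := by
    have : ContDiffAt ℝ 1 (deriv (F.u p)) r := h2.derivWithin (by norm_num)
    exact (this.differentiableAt (by norm_num)).hasDerivAt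
  have h3 := (hasDerivAt_id r).mul h1
  have h4 : F.flux p =ᶠ[nhds r] (id * deriv (F.u p)) := by
    filter_upwards [isOpen_Ioo.mem_nhds hr] with x hx using F.flux_eq hx
  refine (h3.congr_of_eventuallyEq h4).congr_deriv ?_
  rw [← F.ode p hp r hr]
  have := hr.1.ne'
  simp only [id]
  field_simp
  ring

theorem inner_solution (hp : 1 < p) :
    PosRadialSolution p (fun r => -F.u p r) (fun r => -F.flux p r) 0 (F.rp p) where
  nonneg_left := le_rfl
  cont := ((F.smooth p hp).continuousOn.mono (Icc_subset_Icc le_rfl (F.rp_mem p hp).2.le)).neg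
  cont_flux := ((F.continuousOn_flux hp).mono (Icc_subset_Icc le_rfl (F.rp_mem p hp).2.le)).neg
  deriv r hr := by
    have := (F.hasDerivAt_u hp ⟨hr.1, hr.2.trans (F.rp_mem p hp).2⟩).neg
    rw [← neg_div] at this
    exact this
  deriv_flux r hr := by
    have hu := F.neg_in p hp r ⟨hr.1.le, hr.2⟩
    refine (F.hasDerivAt_flux hp ⟨hr.1, hr.2.trans (F.rp_mem p hp).2⟩).neg.congr_deriv ?_
    have h1 : (-F.u p r) ^ p = (-F.u p r) ^ (p - 1) * (-F.u p r) := by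
      rw [← Real.rpow_add_one (by linarith)]; congr 1; ring
    rw [abs_of_neg hu, h1]
    ring
  pos r hr := neg_pos.2 (F.neg_in p hp r ⟨hr.1.le, hr.2⟩)

theorem outer_solution (hp : 1 < p) :
    PosRadialSolution p (F.u p) (F.flux p) (F.rp p) 1 where
  nonneg_left := (F.rp_mem p hp).1.le
  cont := (F.smooth p hp).continuousOn.mono (Icc_subset_Icc (F.rp_mem p hp).1.le le_rfl)
  cont_flux := (F.continuousOn_flux hp).mono (Icc_subset_Icc (F.rp_mem p hp).1.le le_rfl)
  deriv r hr := F.hasDerivAt_u hp ⟨(F.rp_mem p hp).1.trans hr.1, hr.2⟩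
  deriv_flux r hr := by
    have hu := F.pos_out p hp r hr
    refine (F.hasDerivAt_flux hp ⟨(F.rp_mem p hp).1.trans hr.1, hr.2⟩).congr_deriv ?_
    have h1 : F.u p r ^ p = F.u p r ^ (p - 1) * F.u p r := by
      rw [← Real.rpow_add_one hu.ne']; congr 1; ring
    rw [abs_of_pos hu, h1]
  pos r hr := F.pos_out p hp r hr

theorem flux_sp (hp : 1 < p) : F.flux p (F.sp p) = 0 := by
  have hs : F.sp p ∈ Ioo (0 : ℝ) 1 :=
    ⟨(F.rp_mem p hp).1.trans (F.sp_mem p hp).1, (F.sp_mem p hp).2⟩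
  have hmax : IsLocalMax (F.u p) (F.sp p) := by
    filter_upwards [Icc_mem_nhds hs.1 hs.2] with x hx using F.sp_max p hp x hx
  rw [F.flux_eq hs, hmax.deriv_eq_zero, mul_zero]

/-- The maximum of the positive part dominates `p` times the flux through the nodal circle. -/
theorem mul_flux_le (hp : 2 ≤ p) :
    0 < F.flux p (F.rp p) ∧
      F.flux p (F.rp p) / 2 * (Real.exp (-8) * p) ≤ F.u p (F.sp p) := by
  have hp1 : 1 < p := by linarith
  have hρ := F.rp_mem p hp1
  have hs := F.sp_mem p hp1
  have hout := F.outer_solution hp1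
  have hin := F.inner_solution hp1
  have hD : 0 < F.flux p (F.rp p) := by
    by_contra hD
    push Not at hD
    have h1 := (hout.mono le_rfl hs.2.le).sub_le_log hρ.1 hs.1.le (c := 0)
      (fun r hr => ((hout.mono le_rfl (hr.2.trans hs.2).le).flux_anti hr.1.le
        (by linarith)).trans hD)
    rw [F.rp_zero p hp1] at h1
    have := F.pos_out p hp1 _ hs
    linarith
  have hc := F.center_neg p hp1
  have hflux0 : -F.flux p 0 = 0 := by simp [flux]
  have hle : ∀ r ∈ Ioo 0 (F.rp p), -F.u p r ≤ -F.u p 0 := fun r hr =>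
    neg_le_neg (F.min_at_zero p hp1 r ⟨hr.1.le, (hr.2.trans hρ.2).le⟩)
  have hz : -F.u p (F.rp p) = 0 := by rw [F.rp_zero p hp1, neg_zero]
  have h1 := hin.neg_flux_le hρ.1.le (by linarith) hflux0 (by linarith) hle hz
  have h2 := hin.center_height hρ.1 hp hflux0 (by linarith) hle hz
  rw [neg_neg] at h1
  exact ⟨hD, (hout.mono le_rfl hs.2.le).height_ge hρ.1 hs.1 hp (F.rp_zero p hp1) hD
    (F.flux_sp hp1) (Real.exp_pos _)
    (flux_smallness hp (by linarith) hD h1 hρ.1 h2)⟩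

/-- The rescaled maximum point `s_p / ε_p⁺` is bounded uniformly in `p`. -/
theorem sp_sq_mul_le (hp : 2 ≤ p) :
    F.sp p ^ 2 * (p * F.u p (F.sp p) ^ (p - 1)) ≤
      (2 / Real.exp (-8)) ^ 2 + 2 * (2 / Real.exp (-8)) := by
  have hp1 : 1 < p := by linarith
  have hs := F.sp_mem p hp1
  have hρ := F.rp_mem p hp1
  obtain ⟨hD, hDM⟩ := F.mul_flux_le hp
  have hM := F.pos_out p hp1 _ hs
  have hpoh := ((F.outer_solution hp1).mono le_rfl hs.2.le).pohozaev hs.1.le (by linarith)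
    (K := F.u p (F.sp p))
    (fun r hr => F.sp_max p hp1 r ⟨(hρ.1.trans hr.1).le, (hr.2.trans hs.2).le⟩)
  rw [F.flux_sp hp1, F.rp_zero p hp1, Real.zero_rpow (by linarith)] at hpoh
  set M := F.u p (F.sp p)
  set D := F.flux p (F.rp p)
  set k := Real.exp (-8)
  set s := F.sp p
  have hk : 0 < k := Real.exp_pos _
  have hX : p * D / M ≤ 2 / k := by
    rw [div_le_div_iff₀ hM hk]
    linarith
  have hX0 : 0 ≤ p * D / M := by positivity
  have hMp : M ^ (p + 1) = M ^ (p - 1) * M ^ 2 := by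
    rw [← Real.rpow_natCast, ← Real.rpow_add hM]; congr 1; push_cast; ring
  have h1 : s ^ 2 * M ^ (p + 1) ≤ (p + 1) * D ^ 2 / 2 + 2 * M * D := by
    have hpp : 0 < p + 1 := by linarith
    have e1 : s ^ 2 * M ^ (p + 1) = (p + 1) * (s ^ 2 * M ^ (p + 1) / (p + 1)) := by field_simp
    have e2 : (p + 1) * D ^ 2 / 2 + 2 * M * D =
        (p + 1) * (D ^ 2 / 2 + 2 * M / (p + 1) * D) := by field_simp
    rw [e1, e2]
    gcongr
    simpa using hpoh
  have h2 : s ^ 2 * (p * M ^ (p - 1)) * M ^ 2 ≤ ((p * D / M) ^ 2 + 2 * (p * D / M)) * M ^ 2 := by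
    have e3 : ((p * D / M) ^ 2 + 2 * (p * D / M)) * M ^ 2 = p * (p * D ^ 2 + 2 * M * D) := by
      field_simp
    have e4 : s ^ 2 * (p * M ^ (p - 1)) * M ^ 2 = p * (s ^ 2 * M ^ (p + 1)) := by
      rw [hMp]; ring
    rw [e3, e4]
    gcongr
    nlinarith [sq_nonneg D]
  have h3 := le_of_mul_le_mul_right h2 (by positivity)
  refine h3.trans ?_
  gcongr

theorem neg_le_div_epsP (hp : 2 ≤ p) :
    -((2 / Real.exp (-8)) ^ 2 + 2 * (2 / Real.exp (-8)) + 1) ≤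
      (F.rp p - F.sp p) / epsP F p := by
  have hp1 : 1 < p := by linarith
  have hs := F.sp_mem p hp1
  have hρ := F.rp_mem p hp1
  have h := F.sp_sq_mul_le hp
  have hM := F.pos_out p hp1 _ hs
  set C := (2 / Real.exp (-8)) ^ 2 + 2 * (2 / Real.exp (-8))
  have hY : 0 ≤ p * F.u p (F.sp p) ^ (p - 1) := by positivity
  rw [epsP, div_div_eq_mul_div, div_one]
  rw [← Real.sq_sqrt hY] at h
  have hq := Real.sqrt_nonneg (p * F.u p (F.sp p) ^ (p - 1))
  set q := Real.sqrt (p * F.u p (F.sp p) ^ (p - 1))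
  nlinarith [sq_nonneg (F.sp p * q - 1), mul_nonneg hρ.1.le hq, sq_nonneg (F.sp p * q)]

end LaneEmdenFamily

/-- There is no sequence `p_n → +∞` along which
`(r_{p_n} − s_{p_n})/ε_{p_n}⁺ → −∞`. -/
theorem no_seq_tendsto_neg_infty (F : LaneEmdenFamily) :
    ¬ ∃ pn : ℕ → ℝ, (∀ n, 1 < pn n) ∧ Tendsto pn atTop atTop ∧
      Tendsto (fun n => (F.rp (pn n) - F.sp (pn n)) / epsP F (pn n)) atTop atBot := by
  rintro ⟨pn, -, hpn, hlim⟩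
  obtain ⟨n, h2, hn⟩ := ((hpn.eventually_ge_atTop 2).and (hlim.eventually_lt_atBot
    (-((2 / Real.exp (-8)) ^ 2 + 2 * (2 / Real.exp (-8)) + 1)))).exists
  exact absurd (F.neg_le_div_epsP h2) (not_le.2 hn)
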